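/- For every sequence σ and all start times t ≤ t′: the completion time and the total time warp are nondecreasing in the start time, C(σ, t) ≤ C(σ, t′) and W(σ, t) ≤ W(σ, t′); moreover they are jointly 1-Lipschitz, i.e. (C(σ, t′) + W(σ, t′)) − (C(σ, t) + W(σ, t)) ≤ t′ − t. -/

import Mathlib

variable {V : Type*}

/-- Service start time at a visit: `h = max(a v, min(τ, b v))`. -/
noncomputable def svcStart (a b : V → ℝ) (v : V) (t : ℝ) : ℝ :=
  max (a v) (min t (b v))

/-- Completion time `C(σ, t)` of the forward schedule of `σ` started at `t`. -/
noncomputable def comp (a b s : V → ℝ) (d : V → V → ℝ) : List V → ℝ → ℝ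
  | [], t => t
  | [v], t => svcStart a b v t + s v
  | v :: w :: rest, t => comp a b s d (w :: rest) (svcStart a b v t + s v + d v w)

/-- Total time warp `W(σ, t)` of the forward schedule of `σ` started at `t`. -/
noncomputable def warp (a b s : V → ℝ) (d : V → V → ℝ) : List V → ℝ → ℝ
  | [], _ => 0
  | [v], t => max (t - b v) 0
  | v :: w :: rest, t =>
      max (t - b v) 0 + warp a b s d (w :: rest) (svcStart a b v t + s v + d v w)

/-- Active duration `A(σ, t) = C(σ, t) − t + W(σ, t)`. -/
noncomputable def activeDur (a b s : V → ℝ) (d : V → V → ℝ) (σ : List V) (t : ℝ) : ℝ :=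
  comp a b s d σ t - t + warp a b s d σ t

theorem svcStart_mono (a b : V → ℝ) (v : V) : Monotone (svcStart a b v) :=
  fun _ _ h => max_le_max le_rfl (min_le_min h le_rfl)

theorem warp_at_visit_mono (b : V → ℝ) (v : V) : Monotone fun t : ℝ => max (t - b v) 0 :=
  fun _ _ h => max_le_max (sub_le_sub_right h _) le_rfl

/-- Service start plus time warp at a visit is the arrival time, delayed to the window opening. -/
theorem svcStart_add_warp {a b : V → ℝ} {v : V} (hab : a v ≤ b v) (t : ℝ) :
    svcStart a b v t + max (t - b v) 0 = max (a v) t := by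
  unfold svcStart
  grind

theorem max_left_sub_le {x t t' : ℝ} (h : t ≤ t') : max x t' - max x t ≤ t' - t := by
  grind

/-- For every nonempty sequence `σ` and start times `t ≤ t'`, the completion
time and the total time warp are nondecreasing in the start time, and jointly 1-Lipschitz:
`(C(σ,t') + W(σ,t')) − (C(σ,t) + W(σ,t)) ≤ t' − t`. -/
theorem comp_warp_monotone_lipschitz [Fintype V]
    (a b s : V → ℝ) (d : V → V → ℝ)
    (hs : ∀ v, 0 ≤ s v) (hab : ∀ v, a v ≤ b v) (hd : ∀ u v, 0 ≤ d u v)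
    (σ : List V) (hσ : σ ≠ []) (t t' : ℝ) (htt' : t ≤ t') :
    comp a b s d σ t ≤ comp a b s d σ t' ∧
    warp a b s d σ t ≤ warp a b s d σ t' ∧
    (comp a b s d σ t' + warp a b s d σ t') - (comp a b s d σ t + warp a b s d σ t)
      ≤ t' - t := by
  clear hσ
  induction σ generalizing t t' with
  | nil => simp [comp, warp, htt']
  | cons v l ih =>
    have hmono := svcStart_mono a b v htt'
    have hwarp : max (t - b v) 0 ≤ max (t' - b v) 0 := warp_at_visit_mono b v htt'
    have hsum := svcStart_add_warp (hab v) t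
    have hsum' := svcStart_add_warp (hab v) t'
    have hlip := max_left_sub_le (x := a v) htt'
    cases l with
    | nil =>
      simp only [comp, warp]
      refine ⟨?_, ?_, ?_⟩ <;> linarith
    | cons w l =>
      obtain ⟨h₁, h₂, h₃⟩ := ih (svcStart a b v t + s v + d v w)
        (svcStart a b v t' + s v + d v w) (by linarith)
      simp only [comp, warp]
      refine ⟨?_, ?_, ?_⟩ <;> linarith
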